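/- Let m ≥ 1 and let W be a polynomial on ℝ^m, not identically zero, such that the degree of W in each individual variable is at most 2. Let f be a nonnegative measurable function on ℝ^m such that f(x) ≤ C(1+|x|²)^{−D} for some constant C and some D > m/2. Then for every ε with 0 < ε < 1/2, ∫_{ℝ^m} |W(x)|^{−ε} f(x) dx < ∞. -/

import Mathlib

open MeasureTheory

/-- The Japanese bracket weight `(1 + y²)^{-s}`, valued in `ℝ≥0∞`. -/
noncomputable def bracketWeight (s y : ℝ) : ENNReal := ENNReal.ofReal ((1 + y ^ 2) ^ (-s))

lemma measurable_bracketWeight (s : ℝ) : Measurable (bracketWeight s) := by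
  unfold bracketWeight
  fun_prop

lemma lintegral_bracketWeight_lt_top {s : ℝ} (hs : 1 / 2 < s) :
    ∫⁻ y, bracketWeight s y < ⊤ := by
  have h := integrable_rpow_neg_one_add_norm_sq (E := ℝ) (μ := volume) (r := 2 * s)
    (by simp; linarith)
  have e : -(2 * s) / 2 = -s := by ring
  simp only [e, Real.norm_eq_abs, sq_abs] at h
  exact h.lintegral_lt_top

lemma ENNReal.rpow_neg_le_rpow_neg {a b : ENNReal} (h : a ≤ b) {e : ℝ} (he : 0 ≤ e) :
    b ^ (-e) ≤ a ^ (-e) := by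
  rw [ENNReal.rpow_neg, ENNReal.rpow_neg]
  exact ENNReal.inv_le_inv.mpr (ENNReal.rpow_le_rpow h he)

lemma lintegral_enorm_rpow_neg_near_zero_lt_top {δ : ℝ} (h1 : δ < 1) :
    ∫⁻ u : ℝ, (Set.Ioo (-1 : ℝ) 1).indicator (fun u => ‖u‖ₑ ^ (-δ)) u < ⊤ := by
  set H : ℝ → ENNReal := (Set.Ioo (0 : ℝ) 1).indicator (fun u => ENNReal.ofReal (u ^ (-δ)))
    with hH
  have hHm : Measurable H := by
    refine Measurable.indicator ?_ measurableSet_Ioo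
    fun_prop
  have hHfin : ∫⁻ u, H u < ⊤ := by
    rw [hH, lintegral_indicator measurableSet_Ioo]
    have := (intervalIntegral.integrableOn_Ioo_rpow_iff (s := -δ) one_pos).2 (by linarith)
    exact this.lintegral_lt_top
  have hle : ∀ᵐ u : ℝ, (Set.Ioo (-1 : ℝ) 1).indicator (fun u => ‖u‖ₑ ^ (-δ)) u
      ≤ H u + H (-u) := by
    filter_upwards [Measure.ae_ne volume (0 : ℝ)] with u hu
    by_cases hm : u ∈ Set.Ioo (-1 : ℝ) 1
    · rw [Set.indicator_of_mem hm, ← ofReal_norm, Real.norm_eq_abs,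
        ENNReal.ofReal_rpow_of_pos (abs_pos.2 hu)]
      rcases lt_or_gt_of_ne hu with h | h
      · refine le_trans ?_ le_add_self
        rw [hH, Set.indicator_of_mem (by constructor <;> linarith [hm.1]), abs_of_neg h]
      · refine le_trans ?_ le_self_add
        rw [hH, Set.indicator_of_mem (by exact ⟨h, hm.2⟩), abs_of_pos h]
    · simp [Set.indicator_of_notMem hm]
  calc _ ≤ ∫⁻ u, (H u + H (-u)) := lintegral_mono_ae hle
    _ = (∫⁻ u, H u) + ∫⁻ u, H (-u) := lintegral_add_left hHm _
    _ = (∫⁻ u, H u) + ∫⁻ u, H u := by rw [lintegral_neg_eq_self]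
    _ < ⊤ := ENNReal.add_lt_top.2 ⟨hHfin, hHfin⟩

lemma lintegral_comp_one_sub_mul {G : ℝ → ENNReal} (hG : Measurable G) {r : ℝ} (hr : r ≠ 0) :
    ∫⁻ y, G (1 - r * y) = ENNReal.ofReal |r⁻¹| * ∫⁻ u, G u := by
  have hm : Measurable fun u : ℝ => G (1 - u) := hG.comp (by fun_prop)
  rw [← lintegral_map (f := fun u => G (1 - u)) (g := fun y => r * y) hm (by fun_prop),
    Real.map_volume_mul_left hr, lintegral_smul_measure, smul_eq_mul,
    lintegral_sub_left_eq_self G 1]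

lemma abs_mul_bracket_rpow_le {s : ℝ} (hs : 1 / 2 < s) (t : ℝ) :
    |t| * (1 + t ^ 2 / 4) ^ (-s) ≤ 2 := by
  have hp : 0 < 1 + t ^ 2 / 4 := by positivity
  have h1 : |t| ≤ 2 * (1 + t ^ 2 / 4) ^ s := by
    calc |t| ≤ 2 * √(1 + t ^ 2 / 4) := by
          have : |t| / 2 ≤ √(1 + t ^ 2 / 4) := by
            apply Real.le_sqrt_of_sq_le
            rw [div_pow, sq_abs]; linarith
          linarith
      _ = 2 * (1 + t ^ 2 / 4) ^ (1 / 2 : ℝ) := by rw [Real.sqrt_eq_rpow]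
      _ ≤ _ := by
          gcongr
          nlinarith [sq_nonneg t]
  rw [Real.rpow_neg hp.le, ← div_eq_mul_inv, div_le_iff₀ (by positivity)]
  exact h1

/-- Uniform integrability of negative powers of affine functions with constant term `1`. -/
lemma exists_lintegral_affine_rpow_neg_le {s δ : ℝ} (hs : 1 / 2 < s) (h0 : 0 < δ) (h1 : δ < 1) :
    ∃ K : ENNReal, K < ⊤ ∧
      ∀ r : ℝ, ∫⁻ y, ‖1 - r * y‖ₑ ^ (-δ) * bracketWeight s y ≤ K := by
  set G : ℝ → ENNReal := (Set.Ioo (-1 : ℝ) 1).indicator (fun u => ‖u‖ₑ ^ (-δ)) with hG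
  have hGm : Measurable G := by
    refine Measurable.indicator ?_ measurableSet_Ioo
    fun_prop
  have hGf : ∫⁻ u, G u < ⊤ := lintegral_enorm_rpow_neg_near_zero_lt_top h1
  have hc : ∀ c : ℝ, 0 < c → ∀ u : ℝ, c ≤ |u| → ‖u‖ₑ ^ (-δ) ≤ ENNReal.ofReal c ^ (-δ) := by
    intro c hc u hu
    apply ENNReal.rpow_neg_le_rpow_neg _ h0.le
    rw [← ofReal_norm]
    exact ENNReal.ofReal_le_ofReal hu
  set c : ENNReal := ENNReal.ofReal (1 / 2) ^ (-δ) with hcdef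
  have hcf : c < ⊤ := by
    rw [hcdef, ENNReal.ofReal_rpow_of_pos (by norm_num)]
    exact ENNReal.ofReal_lt_top
  refine ⟨c * (∫⁻ y, bracketWeight s y) + 2 * ∫⁻ u, G u, ?_, fun r => ?_⟩
  · exact ENNReal.add_lt_top.2 ⟨ENNReal.mul_lt_top hcf (lintegral_bracketWeight_lt_top hs),
      ENNReal.mul_lt_top (by simp) hGf⟩
  have hpt : ∀ y, ‖1 - r * y‖ₑ ^ (-δ) * bracketWeight s y ≤
      c * bracketWeight s y + ENNReal.ofReal ((1 + r⁻¹ ^ 2 / 4) ^ (-s)) * G (1 - r * y) := by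
    intro y
    by_cases hy : 1 / 2 ≤ |1 - r * y|
    · refine le_trans ?_ le_self_add
      gcongr
      exact hc _ (by norm_num) _ hy
    · refine le_trans ?_ le_add_self
      rw [mul_comm]
      push Not at hy
      have hy' := abs_lt.1 hy
      have hr : r ≠ 0 := by
        rintro rfl
        norm_num at hy
      have hmem : 1 - r * y ∈ Set.Ioo (-1 : ℝ) 1 := ⟨by linarith, by linarith⟩
      rw [hG, Set.indicator_of_mem hmem]
      gcongr
      unfold bracketWeight
      apply ENNReal.ofReal_le_ofReal
      apply Real.rpow_le_rpow_of_nonpos (by positivity) _ (by linarith)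
      have h2 : (r⁻¹) ^ 2 / 4 ≤ y ^ 2 := by
        have h3 : (1 / 2) ^ 2 ≤ (r * y) ^ 2 := by nlinarith
        have h4 : y ^ 2 = r⁻¹ ^ 2 * (r * y) ^ 2 := by field_simp
        rw [h4]
        nlinarith [mul_le_mul_of_nonneg_left h3 (sq_nonneg r⁻¹)]
      linarith
  refine (lintegral_mono hpt).trans ?_
  rw [lintegral_add_left (by have := measurable_bracketWeight s; fun_prop),
    lintegral_const_mul _ (measurable_bracketWeight s),
    lintegral_const_mul _ (show Measurable fun y : ℝ => G (1 - r * y) from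
      hGm.comp (by fun_prop))]
  refine add_le_add_right ?_ _
  by_cases hr : r = 0
  · subst hr
    have : G 1 = 0 := by simp [hG]
    simp [this]
  · rw [lintegral_comp_one_sub_mul hGm hr, ← mul_assoc,
      ← ENNReal.ofReal_mul (by positivity)]
    gcongr
    rw [← ENNReal.ofReal_ofNat 2]
    apply ENNReal.ofReal_le_ofReal
    rw [mul_comm]
    exact abs_mul_bracket_rpow_le hs _

lemma ENNReal.mul_rpow_neg_le_add (a b : ENNReal) {ε : ℝ} (hε : 0 ≤ ε) :
    a ^ (-ε) * b ^ (-ε) ≤ a ^ (-(2 * ε)) + b ^ (-(2 * ε)) := by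
  have key : ∀ x : ENNReal, x ^ (-(2 * ε)) = x ^ (-ε) * x ^ (-ε) := by
    intro x
    rw [ENNReal.rpow_neg, ENNReal.rpow_neg, two_mul, ENNReal.rpow_add_of_nonneg _ _ hε hε]
    by_cases h : x ^ ε = 0
    · simp [h]
    · rw [ENNReal.mul_inv (Or.inl h) (Or.inr h)]
  rw [key, key]
  rcases le_total (a ^ (-ε)) (b ^ (-ε)) with h | h
  · exact le_trans (by gcongr) le_add_self
  · exact le_trans (by gcongr) le_self_add

/-- A real quadratic with value `1` at the origin dominates a product of two real affine
functions with value `1` at the origin. -/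
lemma exists_affine_mul_affine_le_abs_quadratic (a b : ℝ) :
    ∃ α β : ℝ, ∀ y : ℝ, |(1 - α * y) * (1 - β * y)| ≤ |1 + b * y + a * y ^ 2| := by
  by_cases h : b ^ 2 ≤ 4 * a
  · refine ⟨-b / 2, -b / 2, fun y => ?_⟩
    apply abs_le_abs_of_nonneg
    · nlinarith [sq_nonneg (1 - -b / 2 * y)]
    · nlinarith [mul_nonneg (sub_nonneg.2 h) (sq_nonneg y)]
  · push Not at h
    refine ⟨(-b + √(b ^ 2 - 4 * a)) / 2, (-b - √(b ^ 2 - 4 * a)) / 2, fun y => le_of_eq ?_⟩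
    congr 1
    have := Real.sq_sqrt (show 0 ≤ b ^ 2 - 4 * a by linarith)
    linear_combination (-y ^ 2 / 4) * this

lemma exists_lintegral_quadratic_rpow_neg_le_const {s ε : ℝ} (hs : 1 / 2 < s) (h0 : 0 < ε)
    (h1 : ε < 1 / 2) :
    ∃ K : ENNReal, K < ⊤ ∧ ∀ c b a : ℝ,
      ∫⁻ y, ‖c + b * y + a * y ^ 2‖ₑ ^ (-ε) * bracketWeight s y ≤ K * ‖c‖ₑ ^ (-ε) := by
  obtain ⟨K, hK, hle⟩ := exists_lintegral_affine_rpow_neg_le hs (δ := 2 * ε)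
    (by linarith) (by linarith)
  have hw := measurable_bracketWeight s
  refine ⟨K + K + 1, by simp [hK], fun c b a => ?_⟩
  by_cases hc : c = 0
  · subst hc
    rw [enorm_zero, ENNReal.zero_rpow_of_neg (by linarith), ENNReal.mul_top (by simp)]
    exact le_top
  obtain ⟨α, β, hαβ⟩ := exists_affine_mul_affine_le_abs_quadratic (a / c) (b / c)
  have hpt : ∀ y, ‖c + b * y + a * y ^ 2‖ₑ ^ (-ε) * bracketWeight s y ≤
      ‖c‖ₑ ^ (-ε) * (‖1 - α * y‖ₑ ^ (-(2 * ε)) * bracketWeight s y +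
        ‖1 - β * y‖ₑ ^ (-(2 * ε)) * bracketWeight s y) := by
    intro y
    rw [← add_mul, ← mul_assoc]
    gcongr
    have e : c + b * y + a * y ^ 2 = c * (1 + b / c * y + a / c * y ^ 2) := by
      field_simp
    rw [e, enorm_mul, ENNReal.mul_rpow_of_ne_top (by simp) (by simp)]
    gcongr
    refine le_trans ?_ (ENNReal.mul_rpow_neg_le_add _ _ h0.le)
    rw [← ENNReal.mul_rpow_of_ne_top (by simp) (by simp), ← enorm_mul]
    apply ENNReal.rpow_neg_le_rpow_neg _ h0.le
    rw [← ofReal_norm, ← ofReal_norm]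
    exact ENNReal.ofReal_le_ofReal (hαβ y)
  calc _ ≤ _ := lintegral_mono hpt
    _ = ‖c‖ₑ ^ (-ε) * ((∫⁻ y, ‖1 - α * y‖ₑ ^ (-(2 * ε)) * bracketWeight s y) +
        ∫⁻ y, ‖1 - β * y‖ₑ ^ (-(2 * ε)) * bracketWeight s y) := by
      rw [lintegral_const_mul _ (by fun_prop), lintegral_add_left (by fun_prop)]
    _ ≤ ‖c‖ₑ ^ (-ε) * (K + K + 1) := by
      exact mul_le_mul_right ((add_le_add (hle α) (hle β)).trans le_self_add) _
    _ = _ := mul_comm _ _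

lemma bracketWeight_add_le {s : ℝ} (hs : 0 ≤ s) {t : ℝ} (ht : |t| ≤ 1) (y : ℝ) :
    bracketWeight s (y + t) ≤ ENNReal.ofReal (3 ^ s) * bracketWeight s y := by
  unfold bracketWeight
  rw [← ENNReal.ofReal_mul (by positivity)]
  apply ENNReal.ofReal_le_ofReal
  have ht2 : t ^ 2 ≤ 1 := by
    rw [← sq_abs]; nlinarith [abs_nonneg t]
  have h : (1 + y ^ 2) / 3 ≤ 1 + (y + t) ^ 2 := by 
    nlinarith [sq_nonneg (2 * y + 3 * t)]
  calc (1 + (y + t) ^ 2) ^ (-s) ≤ ((1 + y ^ 2) / 3) ^ (-s) :=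
        Real.rpow_le_rpow_of_nonpos (by positivity) h (by linarith)
    _ = _ := by
        rw [Real.div_rpow (by positivity) (by norm_num), Real.rpow_neg (by norm_num : (0:ℝ) ≤ 3)]
        field_simp

/-- Uniform integrability of negative powers of quadratics, normalised by the value at any
point of `[-1, 1]`. -/
lemma exists_lintegral_quadratic_rpow_neg_le_eval {s ε : ℝ} (hs : 1 / 2 < s) (h0 : 0 < ε)
    (h1 : ε < 1 / 2) :
    ∃ K : ENNReal, K < ⊤ ∧ ∀ c b a t : ℝ, |t| ≤ 1 →
      ∫⁻ y, ‖c + b * y + a * y ^ 2‖ₑ ^ (-ε) * bracketWeight s y ≤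
        K * ‖c + b * t + a * t ^ 2‖ₑ ^ (-ε) := by
  obtain ⟨K, hK, hle⟩ := exists_lintegral_quadratic_rpow_neg_le_const hs h0 h1
  have hw := measurable_bracketWeight s
  refine ⟨ENNReal.ofReal (3 ^ s) * K, ENNReal.mul_lt_top (by simp) hK, fun c b a t ht => ?_⟩
  rw [← lintegral_add_right_eq_self _ t, mul_assoc]
  refine le_trans ?_ (mul_le_mul_right (hle _ (b + 2 * a * t) a) _)
  rw [← lintegral_const_mul _ (by fun_prop)]
  refine lintegral_mono fun y => ?_
  have e : c + b * (y + t) + a * (y + t) ^ 2 =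
    (c + b * t + a * t ^ 2) + (b + 2 * a * t) * y + a * y ^ 2 := by ring
  rw [e, mul_left_comm]
  gcongr
  exact bracketWeight_add_le (by linarith) ht y

/-- Each coefficient of a quadratic is controlled by its values at `0`, `1` and `-1`. -/
lemma exists_abs_coeff_le_two_mul_abs_eval (q : Fin 3 → ℝ) (j : Fin 3) :
    ∃ t : ℝ, |t| ≤ 1 ∧ |q j| ≤ 2 * |q 0 + q 1 * t + q 2 * t ^ 2| := by
  by_contra! h
  have z := h 0 (by simp)
  have p := h 1 (by simp)
  have n := h (-1) (by simp)
  norm_num at z p n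
  obtain ⟨z1, z2⟩ := abs_lt.1 (show |2 * q 0| < |q j| by rwa [abs_mul, abs_two])
  obtain ⟨p1, p2⟩ := abs_lt.1 (show |2 * (q 0 + q 1 + q 2)| < |q j| by rwa [abs_mul, abs_two])
  obtain ⟨n1, n2⟩ := abs_lt.1 (show |2 * (q 0 + -q 1 + q 2)| < |q j| by rwa [abs_mul, abs_two])
  fin_cases j <;> simp at * <;> rcases abs_cases (q 0) with h | h <;>
    rcases abs_cases (q 1) with h | h <;> rcases abs_cases (q 2) with h | h <;> linarith

lemma exists_lintegral_quadratic_rpow_neg_le_coeff {s ε : ℝ} (hs : 1 / 2 < s) (h0 : 0 < ε)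
    (h1 : ε < 1 / 2) :
    ∃ K : ENNReal, K < ⊤ ∧ ∀ (q : Fin 3 → ℝ) (j : Fin 3),
      ∫⁻ y, ‖q 0 + q 1 * y + q 2 * y ^ 2‖ₑ ^ (-ε) * bracketWeight s y ≤
        K * ‖q j‖ₑ ^ (-ε) := by
  obtain ⟨K, hK, hle⟩ := exists_lintegral_quadratic_rpow_neg_le_eval hs h0 h1
  refine ⟨K * ENNReal.ofReal (1 / 2) ^ (-ε), ENNReal.mul_lt_top hK ?_, fun q j => ?_⟩
  · rw [ENNReal.ofReal_rpow_of_pos (by norm_num)]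
    exact ENNReal.ofReal_lt_top
  obtain ⟨t, ht, hq⟩ := exists_abs_coeff_le_two_mul_abs_eval q j
  refine (hle _ _ _ t ht).trans ?_
  rw [mul_assoc, ← ENNReal.mul_rpow_of_ne_top (by simp) (by simp)]
  refine mul_le_mul_right (ENNReal.rpow_neg_le_rpow_neg ?_ h0.le) _
  rw [← ofReal_norm, ← ofReal_norm, ← ENNReal.ofReal_mul (by norm_num)]
  apply ENNReal.ofReal_le_ofReal
  simp only [Real.norm_eq_abs]
  linarith

lemma measurable_eval_mvPolynomial {n : ℕ} (W : MvPolynomial (Fin n) ℝ) :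
    Measurable fun x : Fin n → ℝ => MvPolynomial.eval x W :=
  (MvPolynomial.continuous_eval W).measurable

theorem lintegral_mvPolynomial_rpow_neg_mul_bracketWeight_lt_top {s ε : ℝ} (hs : 1 / 2 < s)
    (h0 : 0 < ε) (h1 : ε < 1 / 2) {n : ℕ} (W : MvPolynomial (Fin n) ℝ) (hW : W ≠ 0)
    (hdeg : ∀ i, W.degreeOf i ≤ 2) :
    ∫⁻ x : Fin n → ℝ, ‖MvPolynomial.eval x W‖ₑ ^ (-ε) * ∏ i, bracketWeight s (x i) < ⊤ := by
  have hw := measurable_bracketWeight s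
  induction n with
  | zero =>
    obtain ⟨c, rfl⟩ := MvPolynomial.C_surjective (Fin 0) W
    have hc : c ≠ 0 := by rintro rfl; simp at hW
    simp only [MvPolynomial.eval_C, Finset.univ_eq_empty, Finset.prod_empty, mul_one,
      lintegral_const]
    apply ENNReal.mul_lt_top
    · rw [← ofReal_norm, ENNReal.ofReal_rpow_of_pos (by simpa using hc)]
      exact ENNReal.ofReal_lt_top
    · simp [volume_pi]
  | succ n ih =>
    obtain ⟨K, hK, hle⟩ := exists_lintegral_quadratic_rpow_neg_le_coeff hs h0 h1
    set P := MvPolynomial.finSuccEquiv ℝ n W with hP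
    have hPdeg : P.natDegree < 3 := by
      rw [hP, MvPolynomial.natDegree_finSuccEquiv]
      have := hdeg 0
      omega
    have hP0 : P ≠ 0 := by
      rw [hP]; simpa using hW
    set j : Fin 3 := ⟨P.natDegree, hPdeg⟩
    have hj : P.coeff j ≠ 0 := by simpa [j] using hP0
    have hfin := ih (P.coeff j) hj fun i =>
      (MvPolynomial.degreeOf_coeff_finSuccEquiv W i _).trans (hdeg _)
    have hWm := measurable_eval_mvPolynomial W
    have hCm := measurable_eval_mvPolynomial (P.coeff j)
    have hmeas : Measurable fun x : Fin (n + 1) → ℝ =>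
        ‖MvPolynomial.eval x W‖ₑ ^ (-ε) * ∏ i, bracketWeight s (x i) := by fun_prop
    have hmp := (volume_preserving_piFinSuccAbove (fun _ : Fin (n + 1) => ℝ) 0).symm
    have heval : ∀ (y : ℝ) (x : Fin n → ℝ), MvPolynomial.eval (Fin.cons y x : Fin (n + 1) → ℝ) W =
        MvPolynomial.eval x (P.coeff 0) + MvPolynomial.eval x (P.coeff 1) * y +
          MvPolynomial.eval x (P.coeff 2) * y ^ 2 := by
      intro y x
      rw [MvPolynomial.eval_eq_eval_mv_eval', Polynomial.eval_eq_sum_range'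
        ((Polynomial.natDegree_map_le).trans_lt hPdeg)]
      simp [Finset.sum_range_succ, P]
    rw [← hmp.lintegral_comp hmeas, Measure.volume_eq_prod]
    refine (lintegral_prod_symm _
      (hmeas.comp (MeasurableEquiv.measurable _)).aemeasurable).trans_lt ?_
    have hin : ∀ x : Fin n → ℝ, ∫⁻ y : ℝ,
        ‖MvPolynomial.eval ((MeasurableEquiv.piFinSuccAbove (fun _ : Fin (n + 1) => ℝ) 0).symm
          (y, x)) W‖ₑ ^ (-ε) * ∏ i, bracketWeight s
          ((MeasurableEquiv.piFinSuccAbove (fun _ : Fin (n + 1) => ℝ) 0).symm (y, x) i) ≤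
        K * (‖MvPolynomial.eval x (P.coeff j)‖ₑ ^ (-ε) * ∏ i, bracketWeight s (x i)) := by
      intro x
      have hcons : ∀ y : ℝ, (MeasurableEquiv.piFinSuccAbove (fun _ : Fin (n + 1) => ℝ) 0).symm
          (y, x) = (Fin.cons y x : Fin (n + 1) → ℝ) := fun y => by
        simp [MeasurableEquiv.piFinSuccAbove, Fin.insertNthEquiv]
      simp only [hcons, heval, Fin.prod_univ_succ, Fin.cons_zero, Fin.cons_succ, ← mul_assoc]
      rw [lintegral_mul_const _ (by fun_prop)]
      gcongr
      exact hle (fun k => MvPolynomial.eval x (P.coeff k)) j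
    refine (lintegral_mono hin).trans_lt ?_
    rw [lintegral_const_mul _ (by fun_prop)]
    exact ENNReal.mul_lt_top hK hfin

lemma one_add_sum_sq_rpow_neg_le_prod {m : ℕ} (hm : 1 ≤ m) {D : ℝ} (hD : 0 ≤ D)
    (x : Fin m → ℝ) :
    (1 + ∑ i, x i ^ 2) ^ (-D) ≤ ∏ i, (1 + x i ^ 2) ^ (-(D / m)) := by
  have hm' : (m : ℝ) ≠ 0 := by positivity
  have hS : 0 < 1 + ∑ i, x i ^ 2 := by positivity
  rw [Real.finsetProd_rpow _ _ (fun i _ => by positivity)]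
  calc (1 + ∑ i, x i ^ 2) ^ (-D) = ((1 + ∑ i, x i ^ 2) ^ m) ^ (-(D / m)) := by
        rw [← Real.rpow_natCast, ← Real.rpow_mul hS.le]
        congr 1
        field_simp
    _ ≤ _ := by
        apply Real.rpow_le_rpow_of_nonpos (Finset.prod_pos fun i _ => by positivity) _
          (by simp; positivity)
        calc ∏ i, (1 + x i ^ 2) ≤ ∏ _i : Fin m, (1 + ∑ i, x i ^ 2) := by
              apply Finset.prod_le_prod (fun i _ => by positivity)
              intro i _
              gcongr
              exact Finset.single_le_sum (f := fun i => x i ^ 2) (fun i _ => sq_nonneg _)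
                (Finset.mem_univ i)
          _ = _ := by simp

lemma enorm_abs_rpow_neg_le {ε : ℝ} (h0 : 0 < ε) (t : ℝ) :
    ‖|t| ^ (-ε)‖ₑ ≤ ‖t‖ₑ ^ (-ε) := by
  by_cases ht : t = 0
  · rw [ht, enorm_zero, ENNReal.zero_rpow_of_neg (by linarith)]
    exact le_top
  · rw [← ofReal_norm, ← ofReal_norm, Real.norm_eq_abs, Real.norm_eq_abs,
      ENNReal.ofReal_rpow_of_pos (abs_pos.2 ht), abs_of_nonneg (by positivity)]

/-- Theorem 6.1, first part: if `W` is a nonzero polynomial on `ℝ^m` of degree at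
most 2 in each individual variable and `f` is a nonnegative function bounded by
`C(1+|x|²)^{-D}` with `D > m/2`, then `∫ |W(x)|^{-ε} f(x) dx < ∞` for every
`ε < 1/2`. -/
theorem integrability_negative_power_of_polynomial_deg_two
    {m : ℕ} (hm : 1 ≤ m)
    (W : MvPolynomial (Fin m) ℝ) (hW : W ≠ 0)
    (hdeg : ∀ i : Fin m, W.degreeOf i ≤ 2)
    (f : (Fin m → ℝ) → ℝ) (hfmeas : Measurable f) (hfnonneg : ∀ x, 0 ≤ f x)
    (C D : ℝ) (hC : 0 ≤ C) (hD : (m : ℝ) / 2 < D)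
    (hbound : ∀ x : Fin m → ℝ, f x ≤ C * (1 + ∑ i, x i ^ 2) ^ (-D)) :
    ∀ ε : ℝ, 0 < ε → ε < 1 / 2 →
      Integrable (fun x : Fin m → ℝ => |MvPolynomial.eval x W| ^ (-ε) * f x)
        (volume : Measure (Fin m → ℝ)) := by
  intro ε h0 h1
  have hm0 : (0 : ℝ) < m := by exact_mod_cast hm
  have hs : 1 / 2 < D / m := by
    rw [lt_div_iff₀ hm0]; linarith
  have hWm := measurable_eval_mvPolynomial W
  have hw := measurable_bracketWeight (D / m)
  have hfin := lintegral_mvPolynomial_rpow_neg_mul_bracketWeight_lt_top hs h0 h1 W hW hdeg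
  refine ⟨Measurable.aestronglyMeasurable (by fun_prop), ?_⟩
  have hpt : ∀ x : Fin m → ℝ, ‖|MvPolynomial.eval x W| ^ (-ε) * f x‖ₑ ≤ ENNReal.ofReal C *
      (‖MvPolynomial.eval x W‖ₑ ^ (-ε) * ∏ i, bracketWeight (D / m) (x i)) := by
    intro x
    rw [enorm_mul, mul_left_comm]
    gcongr
    · exact enorm_abs_rpow_neg_le h0 _
    · unfold bracketWeight
      rw [← ENNReal.ofReal_prod_of_nonneg (fun i _ => by positivity), ← ENNReal.ofReal_mul hC,
        ← ofReal_norm, Real.norm_of_nonneg (hfnonneg x)]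
      apply ENNReal.ofReal_le_ofReal
      refine (hbound x).trans ?_
      gcongr
      exact one_add_sum_sq_rpow_neg_le_prod hm (by linarith) x
  refine (lintegral_mono hpt).trans_lt ?_
  rw [lintegral_const_mul _ (by fun_prop)]
  exact ENNReal.mul_lt_top ENNReal.ofReal_lt_top hfin
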